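/- arXiv:1912.09577 — 11 statements merged into one kernel-verified Lean document; each statement's English description precedes it below -/
import Mathlib

section
/- Let ρ > 0, u, π, ψ, Z, e, û, κ ∈ ℝ, a > 0, and M > 0. Let B be the 7×7 real matrix B = [[u, ρ, 0, 0, 0, 0, 0], [0, u, 0, 1/ρ, 0, (1−M²)/(M²ρ), −κ/(M²ρ)], [0, (M²π+(1−M²)ψ)/ρ, u, 0, 0, 0, 0], [0, a²/ρ, 0, u, 0, 0, 0], [0, 0, 0, 0, u, 1/(M²ρ), −κ/(M²ρ)], [0, 0, 0, 0, a²/ρ, u, 0], [0, 0, 0, 0, 0, 0, u]]. Then the characteristic polynomial of B factors as det(X·I − B) = (X − u)³ · ((X − u)² − a²/ρ²) · ((X − u)² − a²/(M²ρ²)). In particular the eigenvalues of B are real, namely u (with multiplicity 3), u ± a/ρ, and u ± a/(Mρ). -/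
open Polynomial

lemma det_relax {R : Type*} [CommRing R] (y r b g k w c d k2 f : R) :
    Matrix.det !![y, r, 0, 0, 0, 0, 0;
                  0, y, 0, b, 0, g, k;
                  0, w, y, 0, 0, 0, 0;
                  0, c, 0, y, 0, 0, 0;
                  0, 0, 0, 0, y, d, k2;
                  0, 0, 0, 0, f, y, 0;
                  0, 0, 0, 0, 0, 0, y] = y ^ 3 * (y ^ 2 - b * c) * (y ^ 2 - d * f) := by
  rw [Matrix.det_succ_column_zero]
  simp [Fin.sum_univ_succ, Matrix.det_succ_row_zero, Fin.succAbove, Matrix.submatrix]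
  ring

/-- The characteristic polynomial of the quasilinear coefficient matrix of the
one-dimensional Suliciu-type relaxation system in primitive variables
`(ρ, u, e, π, û, ψ, Z)` factors as
`(X − u)³ ((X − u)² − a²/ρ²) ((X − u)² − a²/(M²ρ²))`; in particular its
eigenvalues are real, namely `u` (multiplicity 3), `u ± a/ρ` and `u ± a/(Mρ)`. -/
theorem charpoly_relaxation_system
    (ρ u π ψ Z e uh κ a M : ℝ) (hρ : 0 < ρ) (ha : 0 < a) (hM : 0 < M)
    (B : Matrix (Fin 7) (Fin 7) ℝ)
    (hB : B = !![u, ρ, 0, 0, 0, 0, 0;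
                 0, u, 0, 1 / ρ, 0, (1 - M ^ 2) / (M ^ 2 * ρ), -κ / (M ^ 2 * ρ);
                 0, (M ^ 2 * π + (1 - M ^ 2) * ψ) / ρ, u, 0, 0, 0, 0;
                 0, a ^ 2 / ρ, 0, u, 0, 0, 0;
                 0, 0, 0, 0, u, 1 / (M ^ 2 * ρ), -κ / (M ^ 2 * ρ);
                 0, 0, 0, 0, a ^ 2 / ρ, u, 0;
                 0, 0, 0, 0, 0, 0, u]) :
    B.charpoly =
        (X - C u) ^ 3 * ((X - C u) ^ 2 - C (a ^ 2 / ρ ^ 2)) *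
          ((X - C u) ^ 2 - C (a ^ 2 / (M ^ 2 * ρ ^ 2))) ∧
    B.charpoly.roots =
        {u, u, u, u + a / ρ, u - a / ρ, u + a / (M * ρ), u - a / (M * ρ)} := by
  have h1 : B.charpoly =
        (X - C u) ^ 3 * ((X - C u) ^ 2 - C (a ^ 2 / ρ ^ 2)) *
          ((X - C u) ^ 2 - C (a ^ 2 / (M ^ 2 * ρ ^ 2))) := by
    have e1 : a ^ 2 / ρ ^ 2 = (1 / ρ) * (a ^ 2 / ρ) := by field_simp
    have e2 : a ^ 2 / (M ^ 2 * ρ ^ 2) = (1 / (M ^ 2 * ρ)) * (a ^ 2 / ρ) := by field_simp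
    rw [e1, e2, C_mul, C_mul]
    have := det_relax (X - C u) (-C ρ) (-C (1 / ρ)) (-C ((1 - M ^ 2) / (M ^ 2 * ρ)))
      (-C (-κ / (M ^ 2 * ρ))) (-C ((M ^ 2 * π + (1 - M ^ 2) * ψ) / ρ)) (-C (a ^ 2 / ρ))
      (-C (1 / (M ^ 2 * ρ))) (-C (-κ / (M ^ 2 * ρ))) (-C (a ^ 2 / ρ))
    rw [neg_mul_neg, neg_mul_neg] at this
    rw [← this, Matrix.charpoly, hB]
    congr 1
    ext1 i j
    fin_cases i <;> fin_cases j <;>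
      simp [Matrix.charmatrix_apply, -map_div₀, -map_neg, -C_neg, -one_div]
  refine ⟨h1, ?_⟩
  have h2 : B.charpoly = (({u, u, u, u + a / ρ, u - a / ρ, u + a / (M * ρ), u - a / (M * ρ)} :
      Multiset ℝ).map (fun r => X - C r)).prod := by
    have e1 : a ^ 2 / ρ ^ 2 = (a / ρ) ^ 2 := by field_simp
    have e2 : a ^ 2 / (M ^ 2 * ρ ^ 2) = (a / (M * ρ)) ^ 2 := by field_simp
    rw [h1, e1, e2]
    simp only [Multiset.insert_eq_cons, Multiset.map_cons, Multiset.map_singleton,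
      Multiset.prod_cons, Multiset.prod_singleton, C_add, C_sub, C_pow]
    ring
  rw [h2, roots_multiset_prod_X_sub_C]
end

section
/- Let ρ > 0, u, π, ψ, Z, e, û, κ ∈ ℝ, a > 0, and M > 0. Let B be the 7×7 real matrix B = [[u, ρ, 0, 0, 0, 0, 0], [0, u, 0, 1/ρ, 0, (1−M²)/(M²ρ), −κ/(M²ρ)], [0, (M²π+(1−M²)ψ)/ρ, u, 0, 0, 0, 0], [0, a²/ρ, 0, u, 0, 0, 0], [0, 0, 0, 0, u, 0, 0], [0, 0, 0, 0, 0, u, 0], [0, 0, 0, 0, 0, 0, u]]. Then the characteristic polynomial of B factors as det(X·I − B) = (X − u)⁵ · ((X − u)² − a²/ρ²). In particular the eigenvalues of B are real and independent of M, namely u ± a/ρ and u with multiplicity 5. -/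
open Polynomial

theorem det_aux {R : Type*} [CommRing R] (x r p q s k b : R) :
    (!![x, r, 0, 0, 0, 0, 0;
        0, x, 0, p, 0, q, s;
        0, k, x, 0, 0, 0, 0;
        0, b, 0, x, 0, 0, 0;
        0, 0, 0, 0, x, 0, 0;
        0, 0, 0, 0, 0, x, 0;
        0, 0, 0, 0, 0, 0, x] : Matrix (Fin 7) (Fin 7) R).det = x ^ 5 * (x ^ 2 - p * b) := by
  simp [Matrix.det_succ_row_zero, Fin.sum_univ_succ, Fin.succAbove]
  ring

/-- The characteristic polynomial of the quasilinear coefficient matrix of the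
explicit subsystem of the IMEX splitting of the one-dimensional Suliciu-type
relaxation system in primitive variables `(ρ, u, e, π, û, ψ, Z)` factors as
`(X − u)⁵ ((X − u)² − a²/ρ²)`; in particular its eigenvalues are real and
independent of `M`, namely `u ± a/ρ` and `u` with multiplicity 5. -/
theorem charpoly_explicit_subsystem
    (ρ u π ψ Z e uh κ a M : ℝ) (hρ : 0 < ρ) (ha : 0 < a) (hM : 0 < M)
    (B : Matrix (Fin 7) (Fin 7) ℝ)
    (hB : B = !![u, ρ, 0, 0, 0, 0, 0;
                 0, u, 0, 1 / ρ, 0, (1 - M ^ 2) / (M ^ 2 * ρ), -κ / (M ^ 2 * ρ);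
                 0, (M ^ 2 * π + (1 - M ^ 2) * ψ) / ρ, u, 0, 0, 0, 0;
                 0, a ^ 2 / ρ, 0, u, 0, 0, 0;
                 0, 0, 0, 0, u, 0, 0;
                 0, 0, 0, 0, 0, u, 0;
                 0, 0, 0, 0, 0, 0, u]) :
    B.charpoly = (X - C u) ^ 5 * ((X - C u) ^ 2 - C (a ^ 2 / ρ ^ 2)) ∧
    B.charpoly.roots = {u, u, u, u, u, u + a / ρ, u - a / ρ} := by
  have h1 : B.charpoly = (X - C u) ^ 5 * ((X - C u) ^ 2 - C (a ^ 2 / ρ ^ 2)) := by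
    have hm : B.charmatrix = !![X - C u, -C ρ, 0, 0, 0, 0, 0;
        0, X - C u, 0, -C (1 / ρ), 0, -C ((1 - M ^ 2) / (M ^ 2 * ρ)), -C (-κ / (M ^ 2 * ρ));
        0, -C ((M ^ 2 * π + (1 - M ^ 2) * ψ) / ρ), X - C u, 0, 0, 0, 0;
        0, -C (a ^ 2 / ρ), 0, X - C u, 0, 0, 0;
        0, 0, 0, 0, X - C u, 0, 0;
        0, 0, 0, 0, 0, X - C u, 0;
        0, 0, 0, 0, 0, 0, X - C u] := by
      subst hB
      ext1 i j
      fin_cases i <;> fin_cases j <;> simp [Matrix.charmatrix_apply, Matrix.diagonal_apply]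
    rw [Matrix.charpoly, hm, det_aux, neg_mul_neg, ← C_mul]
    have hk : 1 / ρ * (a ^ 2 / ρ) = a ^ 2 / ρ ^ 2 := by field_simp
    rw [hk]
  refine ⟨h1, ?_⟩
  have h2 : B.charpoly = (({u, u, u, u, u, u + a / ρ, u - a / ρ} : Multiset ℝ).map
      (fun t => X - C t)).prod := by
    rw [h1]
    have : C (a ^ 2 / ρ ^ 2) = (C (a / ρ) : ℝ[X]) ^ 2 := by
      rw [← C_pow, div_pow]
    rw [this]
    simp only [Multiset.insert_eq_cons, Multiset.map_cons, Multiset.prod_cons,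
      Multiset.map_singleton, Multiset.prod_singleton, C_add, C_sub]
    ring
  rw [h2, roots_multiset_prod_X_sub_C]
end

section
/- Let N ≥ 1, let μ > 0, and let τ₁, …, τ_N, σ₁, …, σ_N, σ'₁, …, σ'_N be nonnegative real numbers. Let A be the N×N tridiagonal real matrix with diagonal entries A_{ii} = 1 + μ τ_i (σ_i + σ'_i), super-diagonal entries A_{i,i+1} = −μ τ_i σ_i, sub-diagonal entries A_{i,i−1} = −μ τ_i σ'_i, and all other entries zero. Then A is strictly diagonally dominant by rows (for each row, the diagonal entry strictly exceeds the sum of the absolute values of the off-diagonal entries) and A is invertible. -/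
/-- A sum of a nonnegative constant over indices satisfying a predicate that holds at most once. -/
theorem sum_ite_le_of_unique {N : ℕ} (s : Finset (Fin N)) (p : Fin N → Prop) [DecidablePred p]
    (hp : ∀ j k, p j → p k → j = k) (c : ℝ) (hc : 0 ≤ c) :
    ∑ j ∈ s, (if p j then c else 0) ≤ c := by
  rw [← Finset.sum_filter, Finset.sum_const, nsmul_eq_mul]
  have h : (s.filter p).card ≤ 1 := by
    rw [Finset.card_le_one]
    intro a ha b hb
    exact hp a b (Finset.mem_filter.mp ha).2 (Finset.mem_filter.mp hb).2
  have h' : ((s.filter p).card : ℝ) ≤ 1 := by exact_mod_cast h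
  nlinarith

/-- The tridiagonal coefficient matrix of the linear implicit pressure update,
with diagonal entries `1 + μ τᵢ (σᵢ + σ'ᵢ)`, super-diagonal `−μ τᵢ σᵢ` and
sub-diagonal `−μ τᵢ σ'ᵢ` (with `μ > 0` and `τ, σ, σ' ≥ 0`) is strictly
diagonally dominant by rows and invertible. -/
theorem implicit_matrix_sdd_invertible
    (N : ℕ) (hN : 1 ≤ N) (μ : ℝ) (hμ : 0 < μ)
    (τ σ σ' : Fin N → ℝ)
    (hτ : ∀ i, 0 ≤ τ i) (hσ : ∀ i, 0 ≤ σ i) (hσ' : ∀ i, 0 ≤ σ' i)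
    (A : Matrix (Fin N) (Fin N) ℝ)
    (hA : ∀ i j : Fin N,
      A i j =
        if (j : ℕ) = (i : ℕ) then 1 + μ * τ i * (σ i + σ' i)
        else if (j : ℕ) = (i : ℕ) + 1 then -(μ * τ i * σ i)
        else if (i : ℕ) = (j : ℕ) + 1 then -(μ * τ i * σ' i)
        else 0) :
    (∀ i : Fin N, ∑ j ∈ Finset.univ.erase i, |A i j| < A i i) ∧ IsUnit A := by
  have key : ∀ i : Fin N, ∑ j ∈ Finset.univ.erase i, |A i j| < A i i := by
    intro i
    have h1 : 0 ≤ μ * τ i * σ i := mul_nonneg (mul_nonneg hμ.le (hτ i)) (hσ i)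
    have h2 : 0 ≤ μ * τ i * σ' i := mul_nonneg (mul_nonneg hμ.le (hτ i)) (hσ' i)
    have e : ∑ j ∈ Finset.univ.erase i, |A i j| ≤
        ∑ j ∈ Finset.univ.erase i, ((if (j : ℕ) = (i : ℕ) + 1 then μ * τ i * σ i else 0)
          + (if (i : ℕ) = (j : ℕ) + 1 then μ * τ i * σ' i else 0)) := by
      apply Finset.sum_le_sum
      intro j hj
      have hne : (j : ℕ) ≠ i := fun h => (Finset.mem_erase.mp hj).1 (Fin.ext h)
      rw [hA, if_neg hne]
      split_ifs <;> simp [abs_of_nonneg h1, abs_of_nonneg h2, h1, h2]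
    rw [Finset.sum_add_distrib] at e
    have a1 := sum_ite_le_of_unique (Finset.univ.erase i)
      (fun j : Fin N => (j : ℕ) = (i : ℕ) + 1) (fun j k hj hk => Fin.ext (by omega)) _ h1
    have a2 := sum_ite_le_of_unique (Finset.univ.erase i)
      (fun j : Fin N => (i : ℕ) = (j : ℕ) + 1) (fun j k hj hk => Fin.ext (by omega)) _ h2
    rw [hA i i, if_pos rfl]
    linarith
  refine ⟨key, ?_⟩
  rw [Matrix.isUnit_iff_isUnit_det, isUnit_iff_ne_zero]
  apply det_ne_zero_of_sum_row_lt_diag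
  intro k
  simp only [Real.norm_eq_abs]
  exact (key k).trans_le (le_abs_self _)
end

section
/- Let N ≥ 3, let μ = (Δt²/Δx²)(a²/M²) > 0 and let τ_i > 0 for i = 1,…,N, with interface values τ_{i+1/2} = (τ_i + τ_{i+1})/2. Suppose the data ψⁿ ∈ ℝ^N, βⁿ ∈ ℝ^N, uⁿ ∈ ℝ^N satisfy the discrete hydrostatic equilibrium conditions: u_iⁿ = 0 for all i, κ_{i+1/2} = 1 for all interfaces, and ψ_{i+1}ⁿ − ψ_iⁿ = β_{i+1}ⁿ − β_iⁿ for all i. Then ψ^{(1)} = ψⁿ is the unique solution of the implicit update system ψ_i^{(1)} − μ τ_i (τ_{i+1/2}(ψ_{i+1}^{(1)} − ψ_i^{(1)}) − τ_{i−1/2}(ψ_i^{(1)} − ψ_{i−1}^{(1)})) = ψ_iⁿ − μ τ_i (τ_{i+1/2} κ_{i+1/2}(β_{i+1}ⁿ − β_iⁿ) − τ_{i−1/2} κ_{i−1/2}(β_iⁿ − β_{i−1}ⁿ)) − (Δt a²/(2Δx)) (u_{i+1}ⁿ − u_{i−1}ⁿ) for the interior indices i (with ψ_0^{(1)} = ψ_0ⁿ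 and ψ_{N+1}^{(1)} = ψ_{N+1}ⁿ prescribed by the equilibrium boundary data); in other words, the implicit step of the scheme is well-balanced. -/
/-- Discrete maximum principle for the homogeneous update system. -/
lemma discrete_max_principle (N : ℕ) (A B d : ℕ → ℝ) (hA : ∀ i, 0 ≤ A i) (hB : ∀ i, 0 ≤ B i)
    (h0 : d 0 = 0) (hN : d (N + 1) = 0)
    (h : ∀ i, 1 ≤ i → i ≤ N → d i = A i * (d (i + 1) - d i) - B i * (d i - d (i - 1))) :
    ∀ i, i ≤ N + 1 → d i ≤ 0 := by
  obtain ⟨m, hm, hmax⟩ := Finset.exists_max_image (Finset.range (N + 2)) d ⟨0, by simp⟩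
  have hle : ∀ i, i ≤ N + 1 → d i ≤ d m := fun i hi =>
    hmax i (Finset.mem_range.2 (by omega))
  have hm' : m < N + 2 := Finset.mem_range.1 hm
  have key : d m ≤ 0 := by
    by_cases hm0 : m = 0
    · rw [hm0, h0]
    by_cases hmN : m = N + 1
    · rw [hmN, hN]
    have e := h m (by omega) (by omega)
    have h1 := mul_nonneg (hA m) (sub_nonneg.2 (hle (m + 1) (by omega)))
    have h2 := mul_nonneg (hB m) (sub_nonneg.2 (hle (m - 1) (by omega)))
    linarith
  exact fun i hi => (hle i hi).trans key

/-- Well-balancedness of the implicit step: if the data is in discrete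
hydrostatic equilibrium (`uⁿ = 0`, `κ_{i+1/2} = 1`,
`ψⁿ_{i+1} − ψⁿ_i = βⁿ_{i+1} − βⁿ_i`), then `ψ⁽¹⁾ = ψⁿ` is the unique solution
of the implicit pressure update system with the equilibrium boundary data. -/
theorem implicit_step_well_balanced
    (N : ℕ) (hN : 3 ≤ N)
    (Δt Δx a M : ℝ) (hΔt : 0 < Δt) (hΔx : 0 < Δx) (ha : 0 < a) (hM : 0 < M)
    (μ : ℝ) (hμdef : μ = Δt ^ 2 / Δx ^ 2 * (a ^ 2 / M ^ 2)) (hμ : 0 < μ)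
    (τ : ℕ → ℝ) (hτ : ∀ i, 0 < τ i)
    (τh : ℕ → ℝ) (hτh : ∀ i, τh i = (τ i + τ (i + 1)) / 2)
    (ψn β u κ : ℕ → ℝ)
    (hu : ∀ i, u i = 0)
    (hκ : ∀ i, κ i = 1)
    (hψβ : ∀ i, ψn (i + 1) - ψn i = β (i + 1) - β i) :
    -- ψⁿ solves the implicit update system in the interior cells …
    (∀ i, 1 ≤ i → i ≤ N →
      ψn i - μ * τ i *
          (τh i * (ψn (i + 1) - ψn i) - τh (i - 1) * (ψn i - ψn (i - 1)))
        = ψn i - μ * τ i *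
            (τh i * κ i * (β (i + 1) - β i)
              - τh (i - 1) * κ (i - 1) * (β i - β (i - 1)))
          - Δt * a ^ 2 / (2 * Δx) * (u (i + 1) - u (i - 1))) ∧
    -- … and it is the unique such solution with the equilibrium boundary data.
    (∀ ψ1 : ℕ → ℝ, ψ1 0 = ψn 0 → ψ1 (N + 1) = ψn (N + 1) →
      (∀ i, 1 ≤ i → i ≤ N →
        ψ1 i - μ * τ i *
            (τh i * (ψ1 (i + 1) - ψ1 i) - τh (i - 1) * (ψ1 i - ψ1 (i - 1)))
          = ψn i - μ * τ i *
              (τh i * κ i * (β (i + 1) - β i)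
                - τh (i - 1) * κ (i - 1) * (β i - β (i - 1)))
            - Δt * a ^ 2 / (2 * Δx) * (u (i + 1) - u (i - 1))) →
      ∀ i, i ≤ N + 1 → ψ1 i = ψn i) := by
  have hτh0 : ∀ i, 0 ≤ τh i := fun i => by
    rw [hτh]; linarith [hτ i, hτ (i + 1)]
  have hsys : ∀ i, 1 ≤ i → i ≤ N →
      ψn i - μ * τ i *
          (τh i * (ψn (i + 1) - ψn i) - τh (i - 1) * (ψn i - ψn (i - 1)))
        = ψn i - μ * τ i *
            (τh i * κ i * (β (i + 1) - β i)
              - τh (i - 1) * κ (i - 1) * (β i - β (i - 1)))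
          - Δt * a ^ 2 / (2 * Δx) * (u (i + 1) - u (i - 1)) := by
    intro i hi _
    obtain ⟨j, rfl⟩ : ∃ j, i = j + 1 := ⟨i - 1, by omega⟩
    simp only [Nat.add_sub_cancel, hu, hκ, hψβ]
    ring
  refine ⟨hsys, fun ψ1 h0 hN1 h i hi => ?_⟩
  have hA : ∀ i, 0 ≤ μ * τ i * τh i := fun i =>
    mul_nonneg (mul_nonneg hμ.le (hτ i).le) (hτh0 i)
  have hB : ∀ i, 0 ≤ μ * τ i * τh (i - 1) := fun i =>
    mul_nonneg (mul_nonneg hμ.le (hτ i).le) (hτh0 _)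
  have p1 := discrete_max_principle N (fun i => μ * τ i * τh i) (fun i => μ * τ i * τh (i - 1))
    (fun i => ψ1 i - ψn i) hA hB (by simp [h0]) (by simp [hN1])
    (fun i h1 h2 => by
      have e := (h i h1 h2).trans (hsys i h1 h2).symm
      linear_combination e) i hi
  have p2 := discrete_max_principle N (fun i => μ * τ i * τh i) (fun i => μ * τ i * τh (i - 1))
    (fun i => ψn i - ψ1 i) hA hB (by simp [h0]) (by simp [hN1])
    (fun i h1 h2 => by
      have e := (h i h1 h2).trans (hsys i h1 h2).symm
      linear_combination -e) i hi
  linarith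
end

section
/- With the intermediate states of the approximate Riemann solver as defined in the context, suppose the left and right data are in hydrostatic equilibrium: u_L = u_R = 0, π_L = ψ_L, π_R = ψ_R, and ψ_R − ψ_L = κ (Z_R − Z_L). Then the Riemann solver is at rest: u* = 0, π*_L = π_L, π*_R = π_R, τ*_L = τ_L, τ*_R = τ_R, e*_L = e_L, and e*_R = e_R. -/
/-- Well-balancedness of the approximate Riemann solver: if the left and right
data are in hydrostatic equilibrium (`u_L = u_R = 0`, `π = ψ` on both sides and
`ψ_R − ψ_L = κ(Z_R − Z_L)`), then the Riemann solver is at rest: all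
intermediate states coincide with the adjacent data. -/
theorem riemann_solver_well_balanced
    (τL τR uL uR πL πR ψL ψR ZL ZR eL eR κ M a : ℝ)
    (hτL : 0 < τL) (hτR : 0 < τR) (hM0 : 0 < M) (hM1 : M ≤ 1) (ha : 0 < a)
    (ustar πLs πRs τLs τRs eLs eRs : ℝ)
    (hustar : ustar = (uL + uR) / 2 -
      1 / (2 * a) * (πR - πL + (1 - M ^ 2) / M ^ 2 * (ψR - ψL)
        - κ / M ^ 2 * (ZR - ZL)))
    (hπLs : πLs = (πL + πR) / 2 - a / 2 * (uR - uL)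
      + (1 - M ^ 2) / (2 * M ^ 2) * (ψR - ψL) - κ / (2 * M ^ 2) * (ZR - ZL))
    (hπRs : πRs = (πL + πR) / 2 - a / 2 * (uR - uL)
      - (1 - M ^ 2) / (2 * M ^ 2) * (ψR - ψL) + κ / (2 * M ^ 2) * (ZR - ZL))
    (hτLs : τLs = τL + (πL - πLs) / a ^ 2)
    (hτRs : τRs = τR + (πR - πRs) / a ^ 2)
    (heLs : eLs = eL - 1 / (2 * a ^ 2) *
      (πL ^ 2 - πLs ^ 2 + (1 - M ^ 2) * (πL - πLs) * ψL))
    (heRs : eRs = eR - 1 / (2 * a ^ 2) *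
      (πR ^ 2 - πRs ^ 2 + (1 - M ^ 2) * (πR - πRs) * ψR))
    -- hydrostatic equilibrium data:
    (huL : uL = 0) (huR : uR = 0) (hπψL : πL = ψL) (hπψR : πR = ψR)
    (hψZ : ψR - ψL = κ * (ZR - ZL)) :
    ustar = 0 ∧ πLs = πL ∧ πRs = πR ∧ τLs = τL ∧ τRs = τR ∧
      eLs = eL ∧ eRs = eR := by
  have hM : M ≠ 0 := hM0.ne'
  have ha' : a ≠ 0 := ha.ne'
  have hψ : ψR = ψL + κ * (ZR - ZL) := by linarith
  subst hπψL hπψR huL huR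
  have h0 : πR - πL + (1 - M ^ 2) / M ^ 2 * (πR - πL) - κ / M ^ 2 * (ZR - ZL) = 0 := by
    rw [hψ]; field_simp; ring
  have h1 : πLs = πL := by
    rw [hπLs, hψ]; field_simp; ring
  have h2 : πRs = πR := by
    rw [hπRs, hψ]; field_simp; ring
  refine ⟨?_, h1, h2, ?_, ?_, ?_, ?_⟩
  · rw [hustar, h0]; ring
  · rw [hτLs, h1]; ring
  · rw [hτRs, h2]; ring
  · rw [heLs, h1]; ring
  · rw [heRs, h2]; ring
end

section
/- Fix left/right data τ_L, τ_R > 0, u_L, u_R, π_L, π_R, ψ_L, ψ_R, Z_L, Z_R, κ ∈ ℝ and M ∈ (0,1], and regard the intermediate specific volumes τ*_L(a), τ*_R(a) of the approximate Riemann solver as functions of the relaxation parameter a > 0. Then τ*_L(a) → τ_L and τ*_R(a) → τ_R as a → ∞; consequently, there exists a₀ > 0 such that for all a ≥ a₀ one has τ*_L(a) > 0 and τ*_R(a) > 0, i.e. the intermediate densities of the Riemann solver are positive for all sufficiently large relaxation parameters. -/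
open Filter

theorem tendsto_aux_quot (t c d : ℝ) :
    Tendsto (fun a : ℝ => t + (c + a * d) / a ^ 2) atTop (nhds t) := by
  have h : Tendsto (fun a : ℝ => a⁻¹) atTop (nhds 0) := tendsto_inv_atTop_zero
  have h2 : Tendsto (fun a : ℝ => t + (c * (a⁻¹ * a⁻¹) + d * a⁻¹)) atTop
      (nhds (t + (c * (0 * 0) + d * 0))) :=
    (((h.mul h).const_mul c).add (h.const_mul d)).const_add t
  have e : t + (c * (0 * 0) + d * 0) = t := by ring
  rw [e] at h2
  refine h2.congr fun a => ?_
  by_cases ha : a = 0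
  · simp [ha]
  · field_simp

/-- As the relaxation parameter `a → ∞`, the intermediate specific volumes of
the approximate Riemann solver tend to the data `τ_L, τ_R`; consequently the
intermediate densities are positive for all sufficiently large `a`. -/
theorem tau_star_positive_for_large_a
    (τL τR uL uR πL πR ψL ψR ZL ZR κ M : ℝ)
    (hτL : 0 < τL) (hτR : 0 < τR) (hM0 : 0 < M) (hM1 : M ≤ 1)
    (πLs πRs τLs τRs : ℝ → ℝ)
    (hπLs : ∀ a : ℝ, πLs a = (πL + πR) / 2 - a / 2 * (uR - uL)
      + (1 - M ^ 2) / (2 * M ^ 2) * (ψR - ψL) - κ / (2 * M ^ 2) * (ZR - ZL))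
    (hπRs : ∀ a : ℝ, πRs a = (πL + πR) / 2 - a / 2 * (uR - uL)
      - (1 - M ^ 2) / (2 * M ^ 2) * (ψR - ψL) + κ / (2 * M ^ 2) * (ZR - ZL))
    (hτLs : ∀ a : ℝ, τLs a = τL + (πL - πLs a) / a ^ 2)
    (hτRs : ∀ a : ℝ, τRs a = τR + (πR - πRs a) / a ^ 2) :
    Tendsto τLs atTop (nhds τL) ∧ Tendsto τRs atTop (nhds τR) ∧
    ∃ a₀ : ℝ, 0 < a₀ ∧ ∀ a : ℝ, a₀ ≤ a → 0 < τLs a ∧ 0 < τRs a := by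
  have hL : Tendsto τLs atTop (nhds τL) := by
    refine (tendsto_aux_quot τL (πL - ((πL + πR) / 2
      + (1 - M ^ 2) / (2 * M ^ 2) * (ψR - ψL) - κ / (2 * M ^ 2) * (ZR - ZL)))
      ((uR - uL) / 2)).congr fun a => ?_
    rw [hτLs, hπLs]
    congr 2
    ring
  have hR : Tendsto τRs atTop (nhds τR) := by
    refine (tendsto_aux_quot τR (πR - ((πL + πR) / 2
      - (1 - M ^ 2) / (2 * M ^ 2) * (ψR - ψL) + κ / (2 * M ^ 2) * (ZR - ZL)))
      ((uR - uL) / 2)).congr fun a => ?_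
    rw [hτRs, hπRs]
    congr 2
    ring
  refine ⟨hL, hR, ?_⟩
  obtain ⟨b, hb⟩ := eventually_atTop.1
    ((hL.eventually (lt_mem_nhds hτL)).and (hR.eventually (lt_mem_nhds hτR)))
  exact ⟨max b 1, lt_of_lt_of_le one_pos (le_max_right _ _),
    fun a ha => hb a ((le_max_left _ _).trans ha)⟩
end

section
/- Fix left/right data τ_L, τ_R > 0, u_L, u_R, π_L, π_R, ψ_L, ψ_R, Z_L, Z_R, κ ∈ ℝ and M ∈ (0,1], and regard the intermediate internal energies e*_L(a), e*_R(a) of the approximate Riemann solver as functions of the relaxation parameter a > 0. Then e*_L(a) → e_L + (u_R − u_L)²/8 and e*_R(a) → e_R + (u_R − u_L)²/8 as a → ∞. Consequently, if e_L > 0 and e_R > 0, there exists a₀ > 0 such that for all a ≥ a₀ one has e*_L(a) > 0 and e*_R(a) > 0, i.e. the intermediate internal energies of the Riemann solver are positive for all sufficiently large relaxation parameters. -/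
open Filter

theorem e_star_aux (c d q k s e0 : ℝ) (p e : ℝ → ℝ)
    (hp : ∀ a : ℝ, p a = c - a / 2 * d)
    (he : ∀ a : ℝ, e a = e0 - 1 / (2 * a ^ 2) * (q ^ 2 - (p a) ^ 2 + k * (q - p a) * s)) :
    Tendsto e atTop (nhds (e0 + d ^ 2 / 8)) := by
  have hF : Continuous (fun b : ℝ => e0 - 1 / 2 * (b ^ 2 * (q ^ 2 + k * q * s)
      - (c * b - d / 2) ^ 2 - k * s * b * (c * b - d / 2))) := by fun_prop
  have h := (hF.tendsto 0).comp (tendsto_inv_atTop_zero (𝕜 := ℝ))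
  have h0 : e0 - 1 / 2 * ((0 : ℝ) ^ 2 * (q ^ 2 + k * q * s)
      - (c * 0 - d / 2) ^ 2 - k * s * 0 * (c * 0 - d / 2)) = e0 + d ^ 2 / 8 := by ring
  rw [h0] at h
  refine h.congr' ?_
  filter_upwards [eventually_gt_atTop (0 : ℝ)] with a ha
  have ha' : a ≠ 0 := ha.ne'
  simp only [Function.comp, he, hp]
  field_simp
  ring

/-- As the relaxation parameter `a → ∞`, the intermediate internal energies of
the approximate Riemann solver tend to `e_{L,R} + (u_R − u_L)²/8`; consequently
if `e_L, e_R > 0` the intermediate internal energies are positive for all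
sufficiently large `a`. -/
theorem e_star_positive_for_large_a
    (τL τR uL uR πL πR ψL ψR ZL ZR eL eR κ M : ℝ)
    (hτL : 0 < τL) (hτR : 0 < τR) (hM0 : 0 < M) (hM1 : M ≤ 1)
    (πLs πRs eLs eRs : ℝ → ℝ)
    (hπLs : ∀ a : ℝ, πLs a = (πL + πR) / 2 - a / 2 * (uR - uL)
      + (1 - M ^ 2) / (2 * M ^ 2) * (ψR - ψL) - κ / (2 * M ^ 2) * (ZR - ZL))
    (hπRs : ∀ a : ℝ, πRs a = (πL + πR) / 2 - a / 2 * (uR - uL)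
      - (1 - M ^ 2) / (2 * M ^ 2) * (ψR - ψL) + κ / (2 * M ^ 2) * (ZR - ZL))
    (heLs : ∀ a : ℝ, eLs a = eL - 1 / (2 * a ^ 2) *
      (πL ^ 2 - (πLs a) ^ 2 + (1 - M ^ 2) * (πL - πLs a) * ψL))
    (heRs : ∀ a : ℝ, eRs a = eR - 1 / (2 * a ^ 2) *
      (πR ^ 2 - (πRs a) ^ 2 + (1 - M ^ 2) * (πR - πRs a) * ψR)) :
    Tendsto eLs atTop (nhds (eL + (uR - uL) ^ 2 / 8)) ∧
    Tendsto eRs atTop (nhds (eR + (uR - uL) ^ 2 / 8)) ∧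
    (0 < eL → 0 < eR →
      ∃ a₀ : ℝ, 0 < a₀ ∧ ∀ a : ℝ, a₀ ≤ a → 0 < eLs a ∧ 0 < eRs a) := by
  have hL : Tendsto eLs atTop (nhds (eL + (uR - uL) ^ 2 / 8)) :=
    e_star_aux ((πL + πR) / 2 + (1 - M ^ 2) / (2 * M ^ 2) * (ψR - ψL)
      - κ / (2 * M ^ 2) * (ZR - ZL)) (uR - uL) πL (1 - M ^ 2) ψL eL πLs eLs
      (fun a => by rw [hπLs]; ring) heLs
  have hR : Tendsto eRs atTop (nhds (eR + (uR - uL) ^ 2 / 8)) :=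
    e_star_aux ((πL + πR) / 2 - (1 - M ^ 2) / (2 * M ^ 2) * (ψR - ψL)
      + κ / (2 * M ^ 2) * (ZR - ZL)) (uR - uL) πR (1 - M ^ 2) ψR eR πRs eRs
      (fun a => by rw [hπRs]; ring) heRs
  refine ⟨hL, hR, fun h1 h2 => ?_⟩
  have e1 := hL.eventually (lt_mem_nhds (show 0 < eL + (uR - uL) ^ 2 / 8 by positivity))
  have e2 := hR.eventually (lt_mem_nhds (show 0 < eR + (uR - uL) ^ 2 / 8 by positivity))
  obtain ⟨N, hN⟩ := eventually_atTop.1 (e1.and e2)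
  exact ⟨max N 1, lt_max_of_lt_right one_pos, fun a ha => hN a ((le_max_left _ _).trans ha)⟩
end

section
/- Let γ > 1, let u₁₀, u₂₀, p₀ ∈ ℝ, and define on ℝ² × ℝ the functions ρ(x₁,x₂,t) = 1 + 0.2 sin(π(x₁ + x₂ − t(u₁₀ + u₂₀))), u(x₁,x₂,t) = (u₁₀, u₂₀), p(x₁,x₂,t) = p₀ + t(u₁₀ + u₂₀) − (x₁ + x₂) + 0.2 cos(π(x₁ + x₂ − t(u₁₀ + u₂₀)))/π, E = p/(γ−1) + (1/2)ρ(u₁₀² + u₂₀²), and the gravitational potential Φ(x₁,x₂) = x₁ + x₂. Then (ρ, u, p) is an exact solution of the two-dimensional compressible Euler equations with gravity: at every point, ∂_t ρ + ∂_{x₁}(ρu₁₀) + ∂_{x₂}(ρu₂₀) = 0; ∂_t(ρu₁₀) + ∂_{x₁}(ρu₁₀²) + ∂_{x₂}(ρu₁₀u₂₀) + ∂_{x₁}p = −ρ ∂_{x₁}Φ; ∂_t(ρu₂₀) + ∂_{x₁}(ρu₁₀u₂₀) + ∂_{x₂}(ρu₂₀²) + ∂_{x₂}p = −ρ ∂_{x₂}Φ;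 and ∂_t E + ∂_{x₁}(u₁₀(E + p)) + ∂_{x₂}(u₂₀(E + p)) = −ρ(u₁₀ ∂_{x₁}Φ + u₂₀ ∂_{x₂}Φ). -/
/-- The manufactured state `ρ = 1 + 0.2 sin(π(x₁+x₂−t(u₁₀+u₂₀)))`, constant
velocity `(u₁₀, u₂₀)`, and
`p = p₀ + t(u₁₀+u₂₀) − (x₁+x₂) + 0.2 cos(π(x₁+x₂−t(u₁₀+u₂₀)))/π`
is an exact solution of the two-dimensional compressible Euler equations with
the gravitational potential `Φ(x₁,x₂) = x₁ + x₂`. -/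
theorem exact_solution_euler_with_gravity
    (γ u10 u20 p0 : ℝ) (hγ : 1 < γ)
    (ρ p E : ℝ → ℝ → ℝ → ℝ) (Φ : ℝ → ℝ → ℝ)
    (hρ : ρ = fun x1 x2 t =>
      1 + 0.2 * Real.sin (Real.pi * (x1 + x2 - t * (u10 + u20))))
    (hp : p = fun x1 x2 t =>
      p0 + t * (u10 + u20) - (x1 + x2)
        + 0.2 * Real.cos (Real.pi * (x1 + x2 - t * (u10 + u20))) / Real.pi)
    (hE : E = fun x1 x2 t =>
      p x1 x2 t / (γ - 1) + 1 / 2 * ρ x1 x2 t * (u10 ^ 2 + u20 ^ 2))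
    (hΦ : Φ = fun x1 x2 => x1 + x2) :
    ∀ x1 x2 t : ℝ,
      -- mass conservation
      (deriv (fun s => ρ x1 x2 s) t + deriv (fun y => ρ y x2 t * u10) x1
          + deriv (fun y => ρ x1 y t * u20) x2 = 0) ∧
      -- x₁-momentum balance
      (deriv (fun s => ρ x1 x2 s * u10) t + deriv (fun y => ρ y x2 t * u10 ^ 2) x1
          + deriv (fun y => ρ x1 y t * u10 * u20) x2 + deriv (fun y => p y x2 t) x1
        = -(ρ x1 x2 t) * deriv (fun y => Φ y x2) x1) ∧
      -- x₂-momentum balance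
      (deriv (fun s => ρ x1 x2 s * u20) t + deriv (fun y => ρ y x2 t * u10 * u20) x1
          + deriv (fun y => ρ x1 y t * u20 ^ 2) x2 + deriv (fun y => p x1 y t) x2
        = -(ρ x1 x2 t) * deriv (fun y => Φ x1 y) x2) ∧
      -- energy balance
      (deriv (fun s => E x1 x2 s) t
          + deriv (fun y => u10 * (E y x2 t + p y x2 t)) x1
          + deriv (fun y => u20 * (E x1 y t + p x1 y t)) x2
        = -(ρ x1 x2 t) *
            (u10 * deriv (fun y => Φ y x2) x1 + u20 * deriv (fun y => Φ x1 y) x2)) := by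
  have hpi : Real.pi ≠ 0 := Real.pi_ne_zero
  intro x1 x2 t
  -- phase derivatives
  have a1 : HasDerivAt (fun y : ℝ => Real.pi * (y + x2 - t * (u10 + u20))) Real.pi x1 := by
    simpa using ((((hasDerivAt_id x1).add_const x2).sub_const (t * (u10 + u20))).const_mul Real.pi)
  have a2 : HasDerivAt (fun y : ℝ => Real.pi * (x1 + y - t * (u10 + u20))) Real.pi x2 := by
    simpa using ((((hasDerivAt_id x2).const_add x1).sub_const (t * (u10 + u20))).const_mul Real.pi)
  have a3 : HasDerivAt (fun s : ℝ => Real.pi * (x1 + x2 - s * (u10 + u20)))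
      (Real.pi * (-(u10 + u20))) t := by
    simpa using ((((hasDerivAt_id t).mul_const (u10 + u20)).const_sub (x1 + x2)).const_mul Real.pi)
  obtain ⟨c, hc⟩ : ∃ c, c = 0.2 * (Real.cos (Real.pi * (x1 + x2 - t * (u10 + u20))) * Real.pi) :=
    ⟨_, rfl⟩
  have r1 : HasDerivAt (fun y => ρ y x2 t) c x1 := by
    rw [hρ, hc]; exact (a1.sin.const_mul 0.2).const_add 1
  have r2 : HasDerivAt (fun y => ρ x1 y t) c x2 := by
    rw [hρ, hc]; exact (a2.sin.const_mul 0.2).const_add 1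
  have r3 : HasDerivAt (fun s => ρ x1 x2 s) (-(u10 + u20) * c) t := by
    rw [hρ, hc]
    refine ((a3.sin.const_mul 0.2).const_add 1).congr_deriv ?_
    ring
  have p1 : HasDerivAt (fun y => p y x2 t) (-ρ x1 x2 t) x1 := by
    rw [hp, hρ]
    refine ((((hasDerivAt_id x1).add_const x2).const_sub (p0 + t * (u10 + u20))).add
      ((a1.cos.const_mul 0.2).div_const Real.pi)).congr_deriv ?_
    field_simp
    ring
  have p2 : HasDerivAt (fun y => p x1 y t) (-ρ x1 x2 t) x2 := by
    rw [hp, hρ]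
    refine ((((hasDerivAt_id x2).const_add x1).const_sub (p0 + t * (u10 + u20))).add
      ((a2.cos.const_mul 0.2).div_const Real.pi)).congr_deriv ?_
    field_simp
    ring
  have p3 : HasDerivAt (fun s => p x1 x2 s) ((u10 + u20) * ρ x1 x2 t) t := by
    rw [hp, hρ]
    refine (((((hasDerivAt_id t).mul_const (u10 + u20)).const_add p0).sub_const (x1 + x2)).add
      ((a3.cos.const_mul 0.2).div_const Real.pi)).congr_deriv ?_
    field_simp
  have e1 : HasDerivAt (fun y => E y x2 t)
      (-ρ x1 x2 t / (γ - 1) + 1 / 2 * c * (u10 ^ 2 + u20 ^ 2)) x1 := by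
    rw [hE]; exact (p1.div_const _).add ((r1.const_mul (1 / 2)).mul_const _)
  have e2 : HasDerivAt (fun y => E x1 y t)
      (-ρ x1 x2 t / (γ - 1) + 1 / 2 * c * (u10 ^ 2 + u20 ^ 2)) x2 := by
    rw [hE]; exact (p2.div_const _).add ((r2.const_mul (1 / 2)).mul_const _)
  have e3 : HasDerivAt (fun s => E x1 x2 s)
      ((u10 + u20) * ρ x1 x2 t / (γ - 1)
        + 1 / 2 * (-(u10 + u20) * c) * (u10 ^ 2 + u20 ^ 2)) t := by
    rw [hE]; exact (p3.div_const _).add ((r3.const_mul (1 / 2)).mul_const _)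
  have f1 : deriv (fun y => Φ y x2) x1 = 1 := by
    rw [hΦ]; exact ((hasDerivAt_id x1).add_const x2).deriv
  have f2 : deriv (fun y => Φ x1 y) x2 = 1 := by
    rw [hΦ]; exact ((hasDerivAt_id x2).const_add x1).deriv
  rw [f1, f2]
  refine ⟨?_, ?_, ?_, ?_⟩
  · rw [r3.deriv, (r1.mul_const u10).deriv, (r2.mul_const u20).deriv]
    ring
  · rw [(r3.mul_const u10).deriv, (r1.mul_const (u10 ^ 2)).deriv,
      ((r2.mul_const u10).mul_const u20).deriv, p1.deriv]
    ring
  · rw [(r3.mul_const u20).deriv, ((r1.mul_const u10).mul_const u20).deriv,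
      (r2.mul_const (u20 ^ 2)).deriv, p2.deriv]
    ring
  · have g1 : deriv (fun y => u10 * (E y x2 t + p y x2 t)) x1 = _ :=
      ((e1.add p1).const_mul u10).deriv
    have g2 : deriv (fun y => u20 * (E x1 y t + p x1 y t)) x2 = _ :=
      ((e2.add p2).const_mul u20).deriv
    rw [e3.deriv, g1, g2]
    ring
end

section
/- Let M, Fr, R, T > 0, let Φ : [0,∞) → ℝ be differentiable, and let u_θ : [0,∞) → ℝ and g : [0,∞) → ℝ be continuous with u_θ(s)² = s·g(s) for all s ≥ 0. Define ρ(r) = exp(−(M²/Fr²)Φ(r)/(R T)), p₀(r) = R T ρ(r), p₂(r) = ∫₀^r ρ(s) g(s) ds, and p(r) = p₀(r) + M² p₂(r). Then p is differentiable on (0,∞) and for every r > 0, p'(r) = M² ρ(r) u_θ(r)²/r − (M²/Fr²) ρ(r) Φ'(r); equivalently, (1/M²) p'(r) = ρ(r) u_θ(r)²/r − (1/Fr²) ρ(r) Φ'(r), so the axisymmetric vortex with zero radial velocity, angular velocity u_θ, density ρ and pressure p is a stationary solution of the radial momentum balance of the non-dimensional Euler equations with gravity. -/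
/-- The axisymmetric vortex with zero radial velocity, angular velocity `u_θ`,
isothermal density `ρ(r) = exp(−(M²/Fr²)Φ(r)/(RT))` and pressure
`p = p₀ + M² p₂` with `p₀ = RTρ` and `p₂(r) = ∫₀^r ρ u_θ²/s ds` satisfies the
stationary radial momentum balance
`(1/M²) p' = ρ u_θ²/r − (1/Fr²) ρ Φ'` of the non-dimensional Euler equations
with gravity. -/
theorem gresho_vortex_with_gravity_stationary
    (M Fr R T : ℝ) (hM : 0 < M) (hFr : 0 < Fr) (hR : 0 < R) (hT : 0 < T)
    (Φ uθ g : ℝ → ℝ) (hΦ : Differentiable ℝ Φ)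
    (huθ : Continuous uθ) (hg : Continuous g)
    (hug : ∀ s : ℝ, 0 ≤ s → uθ s ^ 2 = s * g s)
    (ρ p₀ p₂ p : ℝ → ℝ)
    (hρ : ρ = fun r => Real.exp (-(M ^ 2 / Fr ^ 2) * Φ r / (R * T)))
    (hp₀ : p₀ = fun r => R * T * ρ r)
    (hp₂ : p₂ = fun r => ∫ s in (0 : ℝ)..r, ρ s * g s)
    (hp : p = fun r => p₀ r + M ^ 2 * p₂ r) :
    ∀ r : ℝ, 0 < r →
      HasDerivAt p
        (M ^ 2 * (ρ r * uθ r ^ 2 / r) - M ^ 2 / Fr ^ 2 * (ρ r * deriv Φ r)) r := by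
  intro r hr
  have hcont : Continuous fun s => ρ s * g s := by
    have hΦc := hΦ.continuous
    rw [hρ]
    fun_prop
  have h2 : HasDerivAt p₂ (ρ r * g r) r := by
    rw [hp₂]
    exact intervalIntegral.integral_hasDerivAt_right (hcont.intervalIntegrable _ _)
      (hcont.stronglyMeasurableAtFilter _ _) hcont.continuousAt
  have h1 : HasDerivAt ρ (ρ r * (-(M ^ 2 / Fr ^ 2) * deriv Φ r / (R * T))) r := by
    rw [hρ]
    exact (((hΦ r).hasDerivAt.const_mul (-(M ^ 2 / Fr ^ 2))).div_const (R * T)).exp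
  have h0 : HasDerivAt p₀ (R * T * (ρ r * (-(M ^ 2 / Fr ^ 2) * deriv Φ r / (R * T)))) r := by
    rw [hp₀]
    exact h1.const_mul (R * T)
  have h : HasDerivAt p (R * T * (ρ r * (-(M ^ 2 / Fr ^ 2) * deriv Φ r / (R * T)))
      + M ^ 2 * (ρ r * g r)) r := by
    rw [hp]
    exact h0.add (h2.const_mul (M ^ 2))
  convert h using 1
  rw [hug r hr.le]
  field_simp
  ring
end

section
/- Consider the one-dimensional first-order Godunov-type scheme described in the context, with cell data W_i = (ρ_i, u_i, E_i, π_i, û_i, ψ_i, Z_i) for i = 1,…,N satisfying the discrete hydrostatic equilibrium: u_i = 0, û_i = 0, π_i = ψ_i = p_i, Z_i = β_i, κ_{i+1/2} = 1 for all interfaces, and ψ_{i+1} − ψ_i = κ_{i+1/2}(Z_{i+1} − Z_i) for all i. Then at every interface i+1/2 the approximate Riemann solver is at rest (u*_{i+1/2} = 0 and the intermediate states equal the adjacent cell states), the interface fluxes satisfy F⁻_{i+1/2} = F(W_i) and F⁺_{i−1/2} = F(W_i), and consequently the update of the physical variables w_i = (ρ_i, ρ_i u_i, E_i) satisfies w_i^{n+1}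 = w_i − (Δt/Δx)·Q(F⁻_{i+1/2} − F⁺_{i−1/2}) = w_i for every interior cell i: the scheme is well-balanced. -/
/-- One-dimensional explicit flux of the relaxation system, evaluated on a
state `(ρ, u, E, π, û, ψ, Z)`:
`F(W) = (ρu, ρu² + π + ((1−M²)/M²)ψ, (E + M²π + (1−M²)ψ)u, (ρπ + a²)u,
ρuû, ρψu, ρZu)`. -/
noncomputable def explicitFlux (a M ρ u E π uh ψ Z : ℝ) : Fin 7 → ℝ :=
  ![ρ * u,
    ρ * u ^ 2 + π + (1 - M ^ 2) / M ^ 2 * ψ,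
    (E + M ^ 2 * π + (1 - M ^ 2) * ψ) * u,
    (ρ * π + a ^ 2) * u,
    ρ * u * uh,
    ρ * ψ * u,
    ρ * Z * u]

/-- Well-balancedness of the first-order Godunov-type scheme: for cell data in
discrete hydrostatic equilibrium, at every interface the approximate Riemann
solver is at rest (`u* = 0` and the intermediate states equal the adjacent cell
states), the interface fluxes satisfy `F⁻_{i+1/2} = F(W_i)` and
`F⁺_{i−1/2} = F(W_i)`, and the update of the physical variables
`w_i = (ρ_i, ρ_i u_i, E_i)` leaves them unchanged. -/
theorem first_order_scheme_well_balanced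
    (N : ℕ) (hN : 1 ≤ N)
    (a M Δt Δx : ℝ) (ha : 0 < a) (hM0 : 0 < M) (hM1 : M ≤ 1)
    (hΔt : 0 < Δt) (hΔx : 0 < Δx)
    -- cell data
    (ρ u E π uh ψ Z β p e τ κ : ℕ → ℝ)
    (hρpos : ∀ i, 0 < ρ i)
    (hτ : ∀ i, τ i = 1 / ρ i)
    (hEe : ∀ i, E i = ρ i * e i + M ^ 2 / 2 * ρ i * u i ^ 2)
    -- intermediate states of the approximate Riemann solver at interface i+1/2
    (ustar πLs πRs τLs τRs eLs eRs : ℕ → ℝ)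
    (hustar : ∀ i, ustar i = (u i + u (i + 1)) / 2 -
      1 / (2 * a) * (π (i + 1) - π i
        + (1 - M ^ 2) / M ^ 2 * (ψ (i + 1) - ψ i)
        - κ i / M ^ 2 * (Z (i + 1) - Z i)))
    (hπLs : ∀ i, πLs i = (π i + π (i + 1)) / 2 - a / 2 * (u (i + 1) - u i)
      + (1 - M ^ 2) / (2 * M ^ 2) * (ψ (i + 1) - ψ i)
      - κ i / (2 * M ^ 2) * (Z (i + 1) - Z i))
    (hπRs : ∀ i, πRs i = (π i + π (i + 1)) / 2 - a / 2 * (u (i + 1) - u i)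
      - (1 - M ^ 2) / (2 * M ^ 2) * (ψ (i + 1) - ψ i)
      + κ i / (2 * M ^ 2) * (Z (i + 1) - Z i))
    (hτLs : ∀ i, τLs i = τ i + (π i - πLs i) / a ^ 2)
    (hτRs : ∀ i, τRs i = τ (i + 1) + (π (i + 1) - πRs i) / a ^ 2)
    (heLs : ∀ i, eLs i = e i - 1 / (2 * a ^ 2) *
      (π i ^ 2 - πLs i ^ 2 + (1 - M ^ 2) * (π i - πLs i) * ψ i))
    (heRs : ∀ i, eRs i = e (i + 1) - 1 / (2 * a ^ 2) *
      (π (i + 1) ^ 2 - πRs i ^ 2 + (1 - M ^ 2) * (π (i + 1) - πRs i) * ψ (i + 1)))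
    -- interface fluxes (resting middle wave: F⁻ from W*_i, F⁺ from W*_{i+1})
    (Fm Fp : ℕ → Fin 7 → ℝ)
    (hFm : ∀ i, Fm i = explicitFlux a M (1 / τLs i) (ustar i)
      (1 / τLs i * (eLs i + M ^ 2 / 2 * ustar i ^ 2)) (πLs i)
      (uh i) (ψ i) (Z i))
    (hFp : ∀ i, Fp i = explicitFlux a M (1 / τRs i) (ustar i)
      (1 / τRs i * (eRs i + M ^ 2 / 2 * ustar i ^ 2)) (πRs i)
      (uh (i + 1)) (ψ (i + 1)) (Z (i + 1)))
    -- discrete hydrostatic equilibrium hypotheses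
    (hu : ∀ i, u i = 0) (huh : ∀ i, uh i = 0)
    (hπp : ∀ i, π i = p i) (hψp : ∀ i, ψ i = p i)
    (hZβ : ∀ i, Z i = β i) (hκ : ∀ i, κ i = 1)
    (hψZ : ∀ i, ψ (i + 1) - ψ i = κ i * (Z (i + 1) - Z i)) :
    -- the Riemann solver is at rest at every interface
    (∀ i, ustar i = 0 ∧ πLs i = π i ∧ πRs i = π (i + 1) ∧
      τLs i = τ i ∧ τRs i = τ (i + 1) ∧ eLs i = e i ∧ eRs i = e (i + 1)) ∧
    -- the interface fluxes coincide with the cell fluxes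
    (∀ i, Fm i = explicitFlux a M (ρ i) (u i) (E i) (π i) (uh i) (ψ i) (Z i)) ∧
    (∀ i, Fp i = explicitFlux a M (ρ (i + 1)) (u (i + 1)) (E (i + 1))
      (π (i + 1)) (uh (i + 1)) (ψ (i + 1)) (Z (i + 1))) ∧
    -- and the physical update leaves every interior cell unchanged
    (∀ i, 1 ≤ i → i ≤ N →
      ρ i - Δt / Δx * (Fm i 0 - Fp (i - 1) 0) = ρ i ∧
      ρ i * u i - Δt / Δx * (Fm i 1 - Fp (i - 1) 1) = ρ i * u i ∧
      E i - Δt / Δx * (Fm i 2 - Fp (i - 1) 2) = E i) := by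
  have hM : M ≠ 0 := hM0.ne'
  have ha' : a ≠ 0 := ha.ne'
  have hZ : ∀ i, Z (i + 1) - Z i = π (i + 1) - π i := by
    intro i
    have h := hψZ i
    rw [hκ, one_mul, hψp, hψp] at h
    rw [hπp, hπp, h]
  have hψ : ∀ i, ψ i = π i := fun i => by rw [hψp, hπp]
  have h1 : ∀ i, ustar i = 0 := by
    intro i
    rw [hustar, hZ, hκ, hu, hu, hψ, hψ]
    field_simp
    ring
  have h2 : ∀ i, πLs i = π i := by
    intro i
    rw [hπLs, hZ, hκ, hu, hu, hψ, hψ]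
    field_simp
    ring
  have h3 : ∀ i, πRs i = π (i + 1) := by
    intro i
    rw [hπRs, hZ, hκ, hu, hu, hψ, hψ]
    field_simp
    ring
  have h4 : ∀ i, τLs i = τ i := by
    intro i
    rw [hτLs, h2]
    simp
  have h5 : ∀ i, τRs i = τ (i + 1) := by
    intro i
    rw [hτRs, h3]
    simp
  have h6 : ∀ i, eLs i = e i := by
    intro i
    rw [heLs, h2]
    simp
  have h7 : ∀ i, eRs i = e (i + 1) := by
    intro i
    rw [heRs, h3]
    simp
  have hE : ∀ i, ρ i * (e i + M ^ 2 / 2 * 0 ^ 2) = E i := by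
    intro i
    rw [hEe, hu]
    ring
  have h8 : ∀ i, Fm i =
      explicitFlux a M (ρ i) (u i) (E i) (π i) (uh i) (ψ i) (Z i) := by
    intro i
    rw [hFm, h4, h6, h1, h2, hτ, one_div_one_div, hE, hu]
  have h9 : ∀ i, Fp i = explicitFlux a M (ρ (i + 1)) (u (i + 1)) (E (i + 1))
      (π (i + 1)) (uh (i + 1)) (ψ (i + 1)) (Z (i + 1)) := by
    intro i
    rw [hFp, h5, h7, h1, h3, hτ, one_div_one_div, hE, hu]
  refine ⟨fun i => ⟨h1 i, h2 i, h3 i, h4 i, h5 i, h6 i, h7 i⟩, h8, h9, ?_⟩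
  intro i hi _
  have h10 : Fm i = Fp (i - 1) := by
    rw [h8, h9, Nat.sub_add_cancel hi]
  rw [h10]
  simp
end

section
/- Let Δt > 0, a > 0, M > 0, and let ρ, κ, Z, ψⁿ, ûⁿ, ψ, û be twice differentiable real functions on ℝ with ρ(x) > 0 for all x; set τ = 1/ρ. Suppose the time semi-discrete implicit relations hold pointwise: ρ·(û − ûⁿ)/Δt + (1/M²)(ψ' − κ·Z') = 0 and ρ·(ψ − ψⁿ)/Δt + a²·û' = 0. Then ψ satisfies the linear elliptic equation ψ(x) − Δt² a² τ(x) · ( (1/M²) τ ψ' )'(x) = ψⁿ(x) − Δt² a² τ(x) · ( (1/M²) τ κ Z' )'(x) − Δt a² τ(x) (ûⁿ)'(x) for all x ∈ ℝ. -/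
/-- Elimination of the relaxation velocity `û` in the implicit step: if the
time semi-discrete relations `ρ(û − ûⁿ)/Δt + (1/M²)(ψ' − κZ') = 0` and
`ρ(ψ − ψⁿ)/Δt + a²û' = 0` hold, then the fast pressure `ψ` satisfies the
linear elliptic equation
`ψ − Δt²a²τ((1/M²)τψ')' = ψⁿ − Δt²a²τ((1/M²)τκZ')' − Δta²τ(ûⁿ)'`
with `τ = 1/ρ`. -/
theorem implicit_step_elliptic_equation
    (Δt a M : ℝ) (hΔt : 0 < Δt) (ha : 0 < a) (hM : 0 < M)
    (ρ κ Z ψn un ψ uhat : ℝ → ℝ)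
    (hρpos : ∀ x, 0 < ρ x)
    -- twice differentiable data
    (hρ : Differentiable ℝ ρ) (hρ' : Differentiable ℝ (deriv ρ))
    (hκ : Differentiable ℝ κ) (hκ' : Differentiable ℝ (deriv κ))
    (hZ : Differentiable ℝ Z) (hZ' : Differentiable ℝ (deriv Z))
    (hψn : Differentiable ℝ ψn) (hψn' : Differentiable ℝ (deriv ψn))
    (hun : Differentiable ℝ un) (hun' : Differentiable ℝ (deriv un))
    (hψ : Differentiable ℝ ψ) (hψ' : Differentiable ℝ (deriv ψ))
    (huhat : Differentiable ℝ uhat) (huhat' : Differentiable ℝ (deriv uhat))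
    (τ : ℝ → ℝ) (hτ : τ = fun x => 1 / ρ x)
    -- the time semi-discrete implicit relations
    (hmom : ∀ x, ρ x * (uhat x - un x) / Δt
      + 1 / M ^ 2 * (deriv ψ x - κ x * deriv Z x) = 0)
    (hpre : ∀ x, ρ x * (ψ x - ψn x) / Δt + a ^ 2 * deriv uhat x = 0) :
    ∀ x, ψ x - Δt ^ 2 * a ^ 2 * τ x *
        deriv (fun y => 1 / M ^ 2 * τ y * deriv ψ y) x
      = ψn x - Δt ^ 2 * a ^ 2 * τ x *
          deriv (fun y => 1 / M ^ 2 * τ y * κ y * deriv Z y) x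
        - Δt * a ^ 2 * τ x * deriv un x := by
  intro x
  have hτd : Differentiable ℝ τ := by
    rw [hτ]
    exact (differentiable_const _).div hρ (fun y => (hρpos y).ne')
  have hf : Differentiable ℝ (fun y => 1 / M ^ 2 * τ y * deriv ψ y) :=
    (hτd.const_mul _).mul hψ'
  have hg : Differentiable ℝ (fun y => 1 / M ^ 2 * τ y * κ y * deriv Z y) :=
    ((hτd.const_mul _).mul hκ).mul hZ'
  have hτρ : ∀ y, τ y * ρ y = 1 := by
    intro y
    rw [hτ]
    exact one_div_mul_cancel (hρpos y).ne'
  have key : uhat = fun y => un y - Δt * (1 / M ^ 2 * τ y * deriv ψ y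
      - 1 / M ^ 2 * τ y * κ y * deriv Z y) := by
    funext y
    have h1 : ρ y * (uhat y - un y)
        + Δt * (1 / M ^ 2 * (deriv ψ y - κ y * deriv Z y)) = 0 := by
      have h := hmom y
      generalize 1 / M ^ 2 * (deriv ψ y - κ y * deriv Z y) = c at h ⊢
      field_simp at h
      linarith
    linear_combination τ y * h1 - (uhat y - un y) * hτρ y
  have hd : deriv uhat x = deriv un x
      - Δt * (deriv (fun y => 1 / M ^ 2 * τ y * deriv ψ y) x
        - deriv (fun y => 1 / M ^ 2 * τ y * κ y * deriv Z y) x) := by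
    have h := (hun x).hasDerivAt.sub
      (((hf x).hasDerivAt.sub (hg x).hasDerivAt).const_mul Δt)
    rw [← h.deriv]
    exact congrArg (fun f => deriv f x) key
  have h2 : ρ x * (ψ x - ψn x) + Δt * (a ^ 2 * deriv uhat x) = 0 := by
    have h := hpre x
    generalize a ^ 2 * deriv uhat x = c at h ⊢
    field_simp at h
    linarith
  rw [hd] at h2
  linear_combination τ x * h2 - (ψ x - ψn x) * hτρ x
end
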